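/- arXiv:2604.21542 — 5 statements merged into one kernel-verified Lean document; each statement's English description precedes it below -/
import Mathlib

section
/- Let T > 0, let 0 = t_0 ≤ t_1 ≤ … ≤ t_{J+1} = T be a partition, let ρ : ℝ≥0 → ℝ≥0 be nondecreasing, let u : [0,T] → ℝ^m be continuous, and let α_1, α_2 : ℝ≥0 → ℝ≥0 be class K∞ functions. Let x : [0,T] → ℝ^n, and for each j ∈ {0,…,J} let V_j : [t_j, t_{j+1}] → ℝ≥0 be continuous, differentiable on (t_j, t_{j+1}) with V_j'(t) ≤ ρ(‖u(t)‖) there, with V_{j+1}(t_{j+1}) ≤ V_j(t_{j+1}) for j < J, and with α_1(‖x(t)‖) ≤ V_j(t) for all t ∈ [t_j, t_{j+1}]. If V_0(0) ≤ α_2(c_0) for some c_0 ≥ 0, then for every j and every t ∈ [t_j, t_{j+1}], ‖x(t)‖ ≤ α_1^{-1}( α_2(c_0) + ∫_0^t ρ(‖u(s)‖) ds ). -/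
open Set MeasureTheory

/-- `γ` is a class `𝒦` function (viewed as a function on `[0,∞)`). -/
def IsClassK (γ : ℝ → ℝ) : Prop :=
  ContinuousOn γ (Set.Ici 0) ∧ StrictMonoOn γ (Set.Ici 0) ∧ γ 0 = 0

/-- `γ` is a class `𝒦∞` function: class `𝒦` and unbounded. -/
def IsClassKInf (γ : ℝ → ℝ) : Prop :=
  IsClassK γ ∧ Filter.Tendsto γ Filter.atTop Filter.atTop

/-- A nondecreasing function of the norm of a continuous curve is integrable on compact
intervals. -/
theorem MonotoneOn.integrableOn_comp_norm {E : Type*} [NormedAddCommGroup E]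
    {ρ : ℝ → ℝ} (hρ : MonotoneOn ρ (Ici 0)) {u : ℝ → E} {a b : ℝ}
    (hu : ContinuousOn u (Icc a b)) :
    IntegrableOn (fun s => ρ ‖u s‖) (Icc a b) := by
  obtain ⟨C, hC⟩ := isCompact_Icc.exists_bound_of_continuousOn hu
  have hext : Monotone fun r => ρ (max 0 r) := fun r s hrs =>
    hρ (le_max_left 0 r) (le_max_left 0 s) (max_le_max le_rfl hrs)
  have hmeas : AEMeasurable (fun s => ρ ‖u s‖) (volume.restrict (Icc a b)) := by
    simpa [Function.comp_def] using
      hext.measurable.comp_aemeasurable (hu.norm.aemeasurable measurableSet_Icc)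
  refine Integrable.of_bound hmeas.aestronglyMeasurable (max |ρ 0| |ρ C|) ?_
  filter_upwards [ae_restrict_mem measurableSet_Icc] with s hs
  have hs0 := norm_nonneg (u s)
  exact abs_le_max_abs_abs (hρ self_mem_Ici hs0 hs0)
    (hρ hs0 (hs0.trans (hC s hs)) (hC s hs))

/-- Along flows and jumps, the value of `V` grows at most by the integral of the bound on its
derivative. -/
theorem le_add_integral_of_hybrid_deriv_le {V : ℕ → ℝ → ℝ} {φ : ℝ → ℝ} {t : ℕ → ℝ} {J : ℕ} {c : ℝ}
    (hmono : ∀ j ≤ J, t j ≤ t (j + 1))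
    (hφ : IntegrableOn φ (Icc (t 0) (t (J + 1))))
    (hcont : ∀ j ≤ J, ContinuousOn (V j) (Icc (t j) (t (j + 1))))
    (hderiv : ∀ j ≤ J, ∀ s ∈ Ioo (t j) (t (j + 1)), ∃ d, HasDerivAt (V j) d s ∧ d ≤ φ s)
    (hjump : ∀ j < J, V (j + 1) (t (j + 1)) ≤ V j (t (j + 1)))
    (hV0 : V 0 (t 0) ≤ c) :
    ∀ j ≤ J, ∀ s ∈ Icc (t j) (t (j + 1)), V j s ≤ c + ∫ τ in t 0..s, φ τ := by
  have hle : ∀ i j, i ≤ j → j ≤ J + 1 → t i ≤ t j := by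
    intro i j hij
    induction j, hij using Nat.le_induction with
    | base => exact fun _ => le_rfl
    | succ j _ ih => exact fun hj => (ih (by omega)).trans (hmono j (by omega))
  have hflow : ∀ j ≤ J, V j (t j) ≤ c + ∫ τ in t 0..t j, φ τ →
      ∀ s ∈ Icc (t j) (t (j + 1)), V j s ≤ c + ∫ τ in t 0..s, φ τ := by
    intro j hj hstart s hs
    have h0 : t 0 ≤ t j := hle 0 j (by omega) (by omega)
    have hsT : s ≤ t (J + 1) := hs.2.trans (hle (j + 1) (J + 1) (by omega) le_rfl)
    have hgrowth := intervalIntegral.sub_le_integral_of_hasDeriv_right_of_le hs.1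
      ((hcont j hj).mono (Icc_subset_Icc_right hs.2))
      (g' := deriv (V j)) (φ := φ)
      (fun r hr => by
        obtain ⟨d, hd, -⟩ := hderiv j hj r ⟨hr.1, hr.2.trans_le hs.2⟩
        exact hd.differentiableAt.hasDerivAt.hasDerivWithinAt)
      (hφ.mono_set (Icc_subset_Icc h0 hsT))
      (fun r hr => by
        obtain ⟨d, hd, hdφ⟩ := hderiv j hj r ⟨hr.1, hr.2.trans_le hs.2⟩
        exact hd.deriv.trans_le hdφ)
    have hφint : ∀ a b, t 0 ≤ a → a ≤ b → b ≤ t (J + 1) → IntervalIntegrable φ volume a b :=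
      fun a b ha hab hb => (intervalIntegrable_iff_integrableOn_Icc_of_le hab).2
        (hφ.mono_set (Icc_subset_Icc ha hb))
    have hadd := intervalIntegral.integral_add_adjacent_intervals
      (hφint (t 0) (t j) le_rfl h0 (hs.1.trans hsT)) (hφint (t j) s h0 hs.1 hsT)
    linarith
  intro j
  induction j with
  | zero => exact fun hj => hflow 0 hj (by simpa using hV0)
  | succ j ih =>
    exact fun hj => hflow (j + 1) hj ((hjump j hj).trans
      (ih (by omega) _ (right_mem_Icc.2 (hmono j (by omega)))))

/-- Bounded Energy Bounded State estimate from an iISS Lyapunov–Krasovskii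
functional along a hybrid solution. -/
theorem stmt1 (n m : ℕ) (T : ℝ) (hT : 0 < T) (J : ℕ) (t : ℕ → ℝ)
    (ht0 : t 0 = 0) (htJ : t (J + 1) = T)
    (hmono : ∀ j ≤ J, t j ≤ t (j + 1))
    (ρ : ℝ → ℝ) (hρmono : MonotoneOn ρ (Ici 0)) (hρ0 : ∀ s ≥ 0, 0 ≤ ρ s)
    (u : ℝ → EuclideanSpace ℝ (Fin m)) (hu : ContinuousOn u (Icc 0 T))
    (α₁ α₂ : ℝ → ℝ) (hα₁ : IsClassKInf α₁) (hα₂ : IsClassKInf α₂)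
    (α₁inv : ℝ → ℝ)
    (hinv₁ : ∀ s ≥ (0 : ℝ), α₁inv (α₁ s) = s)
    (hinv₂ : ∀ y ≥ (0 : ℝ), α₁ (α₁inv y) = y ∧ 0 ≤ α₁inv y)
    (x : ℝ → EuclideanSpace ℝ (Fin n))
    (V : ℕ → ℝ → ℝ)
    (hVnonneg : ∀ j ≤ J, ∀ s ∈ Icc (t j) (t (j + 1)), 0 ≤ V j s)
    (hcont : ∀ j ≤ J, ContinuousOn (V j) (Icc (t j) (t (j + 1))))
    (hderiv : ∀ j ≤ J, ∀ s ∈ Ioo (t j) (t (j + 1)),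
      ∃ d, HasDerivAt (V j) d s ∧ d ≤ ρ ‖u s‖)
    (hjump : ∀ j < J, V (j + 1) (t (j + 1)) ≤ V j (t (j + 1)))
    (hlower : ∀ j ≤ J, ∀ s ∈ Icc (t j) (t (j + 1)), α₁ ‖x s‖ ≤ V j s)
    (c₀ : ℝ) (hc₀ : 0 ≤ c₀) (hV0 : V 0 0 ≤ α₂ c₀) :
    ∀ j ≤ J, ∀ s ∈ Icc (t j) (t (j + 1)),
      ‖x s‖ ≤ α₁inv (α₂ c₀ + ∫ τ in (0 : ℝ)..s, ρ ‖u τ‖) := by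
  intro j hj s hs
  have hV := le_add_integral_of_hybrid_deriv_le (c := α₂ c₀) (φ := fun τ => ρ ‖u τ‖) hmono
    (hρmono.integrableOn_comp_norm (by rwa [ht0, htJ])) hcont hderiv hjump
    (by rwa [ht0]) j hj s hs
  rw [ht0] at hV
  obtain ⟨heq, hnonneg⟩ := hinv₂ _ ((hVnonneg j hj s hs).trans hV)
  refine (hα₁.1.2.1.le_iff_le (norm_nonneg (x s)) hnonneg).1 ?_
  rw [heq]
  exact (hlower j hj s hs).trans hV
end

section
/- Let α_1 : ℝ≥0 → ℝ≥0 be a class K∞ function, let λ : ℝ≥0 → ℝ≥0 be a class K function, and let q : ℝ≥0 → ℝ be continuous with q(s) > 0 for all s ≥ 0 and q(s) = 1 for all s ∈ [0,1]. Then there exist a constant ω̃ > 0 and a class K function θ : ℝ≥0 → ℝ≥0 such that λ(1/q(s)) ≤ ω̃ + θ(α_1(s)) for all s ≥ 0. -/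
/-- Every continuous real function is bounded on `[0, ∞)` by its initial value plus a class `𝒦`
function. -/
theorem exists_isClassK_le_add {g : ℝ → ℝ} (hg : Continuous g) :
    ∃ θ : ℝ → ℝ, IsClassK θ ∧ ∀ r ≥ (0 : ℝ), g r ≤ g 0 + θ r := by
  set M : ℝ → ℝ := fun r => sSup ((fun t => g (t * r)) '' Set.Icc 0 1) with hM
  have hMc : Continuous M := by
    refine isCompact_Icc.continuous_sSup (f := fun r t => g (t * r)) ?_
    change Continuous fun p : ℝ × ℝ => g (p.2 * p.1)
    fun_prop
  have hbdd (r : ℝ) : BddAbove ((fun t => g (t * r)) '' Set.Icc 0 1) :=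
    (isCompact_Icc.image (by fun_prop)).bddAbove
  have hle {x r : ℝ} (hx : 0 ≤ x) (hxr : x ≤ r) : g x ≤ M r := by
    refine le_csSup (hbdd r) ⟨x / r, ⟨div_nonneg hx (hx.trans hxr),
      div_le_one_of_le₀ hxr (hx.trans hxr)⟩, ?_⟩
    rcases (hx.trans hxr).eq_or_lt with rfl | hr
    · simp [le_antisymm hxr hx]
    · simp [div_mul_cancel₀ x hr.ne']
  have hM0 : M 0 = g 0 := by
    simp [hM, Set.Nonempty.image_const (Set.nonempty_Icc.mpr (zero_le_one (α := ℝ)))]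
  have hmono : MonotoneOn M (Set.Ici 0) := by
    intro a ha b _ hab
    refine csSup_le ((Set.nonempty_Icc.mpr zero_le_one).image _) ?_
    rintro _ ⟨t, ht, rfl⟩
    exact hle (mul_nonneg ht.1 ha) ((mul_le_of_le_one_left ha ht.2).trans hab)
  refine ⟨fun r => M r - M 0 + r, ⟨by fun_prop, ?_, by simp⟩, fun r hr => ?_⟩
  · intro a ha b hb hab
    have := hmono ha hb hab.le
    simp only
    linarith
  · have := hle hr le_rfl
    simp only [hM0]
    linarith

/-- A class `𝒦∞` function agrees on `[0, ∞)` with an order automorphism of `ℝ`. -/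
theorem IsClassKInf.exists_orderIso {α : ℝ → ℝ} (hα : IsClassKInf α) :
    ∃ e : ℝ ≃o ℝ, ∀ s ≥ (0 : ℝ), e s = α s := by
  obtain ⟨⟨hc, hmono, h0⟩, htop⟩ := hα
  set F : ℝ → ℝ := fun s => α (max s 0) + min s 0 with hF
  have hFα (s : ℝ) (hs : 0 ≤ s) : F s = α s := by simp [hF, hs]
  have hFneg (s : ℝ) (hs : s ≤ 0) : F s = s := by simp [hF, hs, h0]
  have hFc : Continuous F :=
    (hc.comp_continuous (by fun_prop) fun s => le_max_right s 0).add (by fun_prop)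
  have hFm : StrictMono F := by
    intro a b hab
    rcases le_or_gt 0 a with ha | ha
    · rw [hFα a ha, hFα b (ha.trans hab.le)]
      exact hmono ha (ha.trans hab.le) hab
    · have : α 0 ≤ α (max b 0) := hmono.monotoneOn Set.self_mem_Ici (le_max_right b 0)
        (le_max_right b 0)
      rw [hFneg a ha.le]
      rcases le_or_gt 0 b with hb | hb
      · rw [max_eq_left hb] at this
        rw [hFα b hb]
        linarith
      · rwa [hFneg b hb.le]
  have hFs : Function.Surjective F := by
    refine hFc.surjective (htop.congr' ?_) (Filter.tendsto_id.congr' ?_)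
    · filter_upwards [Filter.eventually_ge_atTop 0] with s hs using (hFα s hs).symm
    · filter_upwards [Filter.eventually_le_atBot 0] with s hs using (hFneg s hs).symm
  exact ⟨hFm.orderIsoOfSurjective F hFs, hFα⟩

/-- Majorization step: the input-scaling function `q` is absorbed into a
constant `ω̃` plus a class `𝒦` function of `α₁`. -/
theorem stmt5 (α₁ : ℝ → ℝ) (hα₁ : IsClassKInf α₁)
    (lam : ℝ → ℝ) (hlam : IsClassK lam)
    (q : ℝ → ℝ) (hqcont : ContinuousOn q (Set.Ici 0))
    (hqpos : ∀ s ≥ (0 : ℝ), 0 < q s)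
    (hq1 : ∀ s ∈ Set.Icc (0 : ℝ) 1, q s = 1) :
    ∃ ω : ℝ, 0 < ω ∧ ∃ θ : ℝ → ℝ, IsClassK θ ∧
      ∀ s ≥ (0 : ℝ), lam (1 / q s) ≤ ω + θ (α₁ s) := by
  obtain ⟨e, he⟩ := hα₁.exists_orderIso
  obtain ⟨hlc, hlm, hl0⟩ := hlam
  have hqc : Continuous fun s => q (max s 0) :=
    hqcont.comp_continuous (by fun_prop) fun s => le_max_right s 0
  have hqp (s : ℝ) : 0 < q (max s 0) := hqpos _ (le_max_right s 0)
  have hf : Continuous fun s => lam (1 / q (max s 0)) :=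
    hlc.comp_continuous (continuous_const.div hqc fun s => (hqp s).ne')
      fun s => (one_div_pos.mpr (hqp s)).le
  obtain ⟨θ, hθ, hle⟩ := exists_isClassK_le_add (hf.comp e.symm.continuous)
  have he0 : e.symm 0 = 0 := by
    rw [e.symm_apply_eq, he 0 le_rfl, hα₁.1.2.2]
  refine ⟨lam 1, ?_, θ, hθ, fun s hs => ?_⟩
  · simpa [hl0] using hlm Set.self_mem_Ici (Set.mem_Ici.mpr zero_le_one) zero_lt_one
  · have hαs : 0 ≤ α₁ s := by
      simpa [hα₁.1.2.2] using hα₁.1.2.1.monotoneOn Set.self_mem_Ici hs hs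
    simpa [← he s hs, he0, hs, hq1 0 (by simp)] using hle (α₁ s) hαs
end

section
/- Let ω̃ > 0, a > 0, let θ : ℝ≥0 → ℝ≥0 be continuous and nondecreasing, and define π(r) = ∫_0^r ds/(ω̃ + θ(s)). Let v : [0,T] → ℝ≥0 be continuous on [0,T] and differentiable on (0,T), let m : [0,T] → ℝ≥0, and suppose v'(t) ≤ -a·v(t) + m(t) for all t ∈ (0,T). Then p := π ∘ v is differentiable on (0,T) and satisfies p'(t) ≤ -( a·ω̃ / (ω̃ + θ(v(t))) )·p(t) + m(t)/ω̃ for all t ∈ (0,T). -/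
open Set

/-- A continuous function on `[0, ∞)`, extended constantly to the left of `0`, is continuous. -/
lemma continuous_comp_max_zero {θ : ℝ → ℝ} (hθ : ContinuousOn θ (Ici 0)) :
    Continuous fun s => θ (max s 0) :=
  hθ.comp_continuous (by fun_prop) fun s => le_max_right s 0

/-- Scalar chain-rule computation: composing a dissipative scalar function `v`
with the rescaling `π(r) = ∫₀ʳ ds/(ω̃ + θ(s))` yields an exponential-type
dissipation inequality. -/
theorem stmt7 (T : ℝ) (hT : 0 < T) (ω a : ℝ) (hω : 0 < ω) (ha : 0 < a)
    (θ : ℝ → ℝ) (hθcont : ContinuousOn θ (Ici 0))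
    (hθmono : MonotoneOn θ (Ici 0)) (hθnonneg : ∀ s ≥ (0 : ℝ), 0 ≤ θ s)
    (π : ℝ → ℝ) (hπ : ∀ r ≥ (0 : ℝ), π r = ∫ s in (0 : ℝ)..r, 1 / (ω + θ s))
    (v : ℝ → ℝ) (hvcont : ContinuousOn v (Icc 0 T))
    (hvnonneg : ∀ t ∈ Icc (0 : ℝ) T, 0 ≤ v t)
    (v' : ℝ → ℝ) (hvderiv : ∀ t ∈ Ioo (0 : ℝ) T, HasDerivAt v (v' t) t)
    (m : ℝ → ℝ) (hm : ∀ t ∈ Icc (0 : ℝ) T, 0 ≤ m t)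
    (hineq : ∀ t ∈ Ioo (0 : ℝ) T, v' t ≤ -a * v t + m t) :
    ∀ t ∈ Ioo (0 : ℝ) T, ∃ d : ℝ,
      HasDerivAt (fun s => π (v s)) d t ∧
      d ≤ -(a * ω / (ω + θ (v t))) * π (v t) + m t / ω := by
  intro t ht
  have htI : t ∈ Icc (0 : ℝ) T := Ioo_subset_Icc_self ht
  have hv0 := hvnonneg t htI
  let g : ℝ → ℝ := fun s => 1 / (ω + θ (max s 0))
  have hpos : ∀ s, 0 < ω + θ (max s 0) := fun s =>
    add_pos_of_pos_of_nonneg hω (hθnonneg _ (le_max_right s 0))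
  have hg : Continuous g :=
    continuous_const.div (continuous_const.add (continuous_comp_max_zero hθcont))
      fun s => (hpos s).ne'
  have hg_le : ∀ s, g s ≤ 1 / ω := fun s =>
    one_div_le_one_div_of_le hω (le_add_of_nonneg_right (hθnonneg _ (le_max_right s 0)))
  have hπg : ∀ r ≥ (0 : ℝ), π r = ∫ s in (0 : ℝ)..r, g s := by
    intro r hr
    rw [hπ r hr]
    refine intervalIntegral.integral_congr fun s hs => ?_
    rw [uIcc_of_le hr] at hs
    simp only [g, max_eq_left hs.1]
  have hgv : g (v t) = 1 / (ω + θ (v t)) := by simp only [g, max_eq_left hv0]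
  have hπ_le : ω * π (v t) ≤ v t := by
    have h : ∫ s in (0 : ℝ)..v t, g s ≤ ∫ _ in (0 : ℝ)..v t, 1 / ω :=
      intervalIntegral.integral_mono hv0 (hg.intervalIntegrable _ _)
        intervalIntegrable_const hg_le
    rw [← hπg _ hv0, intervalIntegral.integral_const, smul_eq_mul, sub_zero, mul_one_div,
      le_div_iff₀ hω] at h
    linarith
  refine ⟨g (v t) * v' t, ?_, ?_⟩
  · have hG : HasDerivAt (fun r => ∫ s in (0 : ℝ)..r, g s) (g (v t)) (v t) :=
      hg.integral_hasStrictDerivAt 0 (v t) |>.hasDerivAt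
    refine (hG.comp t (hvderiv t ht)).congr_of_eventuallyEq ?_
    filter_upwards [Ioo_mem_nhds ht.1 ht.2] with s hs
    exact hπg _ (hvnonneg s (Ioo_subset_Icc_self hs))
  · have hg0 : 0 ≤ g (v t) := (one_div_pos.2 (hpos _)).le
    calc g (v t) * v' t ≤ g (v t) * (-a * v t + m t) :=
          mul_le_mul_of_nonneg_left (hineq t ht) hg0
      _ = -(a * g (v t) * v t) + g (v t) * m t := by ring
      _ ≤ -(a * g (v t) * (ω * π (v t))) + 1 / ω * m t := by
          gcongr
          · exact hm t htI
          · exact hg_le _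
      _ = -(a * ω / (ω + θ (v t))) * π (v t) + m t / ω := by rw [hgv]; ring
end

section
/- Let n, m ∈ ℕ, r > 0, σ > 0, μ > 0, η ≥ 0, ε_1 > 0, ε_2 > 0, κ ∈ ℝ. Let A : ℝ^n → ℝ^n and B : ℝ^m → ℝ^n be continuous linear maps with ⟨y, A y⟩ ≤ κ·‖y‖² for every y ∈ ℝ^n, and let c_K ≥ 0. Let x : ℝ → ℝ^n be differentiable, u : ℝ → ℝ^m, and φ : ℝ → ℝ^m with ‖φ(t)‖ ≤ c_K·‖x(t−r)‖ for all t, and suppose x'(t) = A x(t) + B φ(t) + B u(t) for all t. Define V(t) = σ·‖x(t)‖² + μ·∫_{t−r}^{t} e^{η(s−t)}·‖x(s)‖² ds. Then V is differentiable and for every t, V'(t) ≤ (2σκ + μ + ε_1 + ε_2)·‖x(t)‖² + ( σ²·‖B‖²·c_K²/ε_1 − μ·e^{−ηr} )·‖x(t−r)‖² + ( σ²·‖B‖²/ε_2 )·‖u(t)‖². -/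
open Set
open scoped RealInnerProductSpace

/-- Leibniz rule for an exponentially weighted integral over a sliding window. -/
theorem hasDerivAt_integral_exp_mul_window {g : ℝ → ℝ} (hg : Continuous g) (η r t : ℝ) :
    HasDerivAt (fun t => ∫ s in (t - r)..t, Real.exp (η * (s - t)) * g s)
      (g t - Real.exp (-(η * r)) * g (t - r) -
        η * ∫ s in (t - r)..t, Real.exp (η * (s - t)) * g s) t := by
  set h : ℝ → ℝ := fun s => Real.exp (η * s) * g s with hh
  have hc : Continuous h := by fun_prop
  have hexp (a b : ℝ) : Real.exp (η * (a - b)) = Real.exp (-(η * b)) * Real.exp (η * a) := by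
    rw [← Real.exp_add]; ring_nf
  have hint (t : ℝ) : ∫ s in (t - r)..t, Real.exp (η * (s - t)) * g s =
      Real.exp (-(η * t)) * ((∫ s in (0 : ℝ)..t, h s) - ∫ s in (0 : ℝ)..(t - r), h s) := by
    rw [intervalIntegral.integral_interval_sub_left (hc.intervalIntegrable _ _)
      (hc.intervalIntegrable _ _), ← intervalIntegral.integral_const_mul]
    simp only [hh, hexp, mul_assoc]
  have hd (b : ℝ) : HasDerivAt (fun t => ∫ s in (0 : ℝ)..t, h s) (h b) b :=
    intervalIntegral.integral_hasDerivAt_right (hc.intervalIntegrable _ _)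
      (hc.stronglyMeasurableAtFilter _ _) hc.continuousAt
  have hE : HasDerivAt (fun t => Real.exp (-(η * t))) (Real.exp (-(η * t)) * -(η * 1)) t :=
    ((hasDerivAt_id t).const_mul η).neg.exp
  simp_rw [hint]
  refine (hE.mul ((hd t).sub ((hd (t - r)).comp_sub_const t r))).congr_deriv ?_
  have h₁ : Real.exp (-(η * t)) * h t = g t := by
    rw [hh, ← mul_assoc, ← hexp]; simp
  have h₂ : Real.exp (-(η * t)) * h (t - r) = Real.exp (-(η * r)) * g (t - r) := by
    rw [hh, ← mul_assoc, ← hexp]; ring_nf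
  simp only [Pi.sub_apply]
  linear_combination h₁ - h₂

/-- Young's inequality for the cross term of a bounded operator. -/
theorem two_mul_inner_apply_le {E F : Type*} [NormedAddCommGroup E] [InnerProductSpace ℝ E]
    [NormedAddCommGroup F] [NormedSpace ℝ F] (B : F →L[ℝ] E) {σ ε : ℝ} (hσ : 0 ≤ σ)
    (hε : 0 < ε) (y : E) (v : F) :
    2 * σ * ⟪y, B v⟫ ≤ ε * ‖y‖ ^ 2 + σ ^ 2 * ‖B‖ ^ 2 / ε * ‖v‖ ^ 2 := by
  have h : ⟪y, B v⟫ ≤ ‖y‖ * (‖B‖ * ‖v‖) :=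
    (real_inner_le_norm _ _).trans (by gcongr; exact B.le_opNorm v)
  have hsq : ε * ‖y‖ ^ 2 + σ ^ 2 * ‖B‖ ^ 2 / ε * ‖v‖ ^ 2 - 2 * σ * (‖y‖ * (‖B‖ * ‖v‖)) =
      (ε * ‖y‖ - σ * ‖B‖ * ‖v‖) ^ 2 / ε := by
    field_simp; ring
  have hnonneg : 0 ≤ (ε * ‖y‖ - σ * ‖B‖ * ‖v‖) ^ 2 / ε := by positivity
  have := mul_le_mul_of_nonneg_left h (by positivity : 0 ≤ 2 * σ)
  linarith

/-- Full flow dissipation estimate of the quadcopter example: along solutions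
of the delayed, saturated closed loop, the Lyapunov–Krasovskii functional
satisfies the stated dissipation inequality. -/
theorem stmt14 (n m : ℕ) (r σ μ η ε₁ ε₂ κ : ℝ)
    (hr : 0 < r) (hσ : 0 < σ) (hμ : 0 < μ) (hη : 0 ≤ η)
    (hε₁ : 0 < ε₁) (hε₂ : 0 < ε₂)
    (A : EuclideanSpace ℝ (Fin n) →L[ℝ] EuclideanSpace ℝ (Fin n))
    (B : EuclideanSpace ℝ (Fin m) →L[ℝ] EuclideanSpace ℝ (Fin n))
    (hA : ∀ y : EuclideanSpace ℝ (Fin n), ⟪y, A y⟫ ≤ κ * ‖y‖ ^ 2)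
    (cK : ℝ) (hcK : 0 ≤ cK)
    (x : ℝ → EuclideanSpace ℝ (Fin n))
    (u φ : ℝ → EuclideanSpace ℝ (Fin m))
    (hφ : ∀ t : ℝ, ‖φ t‖ ≤ cK * ‖x (t - r)‖)
    (hx : ∀ t : ℝ, HasDerivAt x (A (x t) + B (φ t) + B (u t)) t)
    (V : ℝ → ℝ)
    (hV : ∀ t : ℝ, V t =
      σ * ‖x t‖ ^ 2 + μ * ∫ s in (t - r)..t, Real.exp (η * (s - t)) * ‖x s‖ ^ 2) :
    (∀ t : ℝ, DifferentiableAt ℝ V t) ∧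
    ∀ t : ℝ, deriv V t ≤
      (2 * σ * κ + μ + ε₁ + ε₂) * ‖x t‖ ^ 2 +
      (σ ^ 2 * ‖B‖ ^ 2 * cK ^ 2 / ε₁ - μ * Real.exp (-(η * r))) * ‖x (t - r)‖ ^ 2 +
      σ ^ 2 * ‖B‖ ^ 2 / ε₂ * ‖u t‖ ^ 2 := by
  have hxc : Continuous x := continuous_iff_continuousAt.2 fun t => (hx t).continuousAt
  have hd (t : ℝ) := ((hx t).norm_sq.const_mul σ).add
    ((hasDerivAt_integral_exp_mul_window (hxc.norm.pow 2) η r t).const_mul μ)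
  obtain rfl := funext hV
  refine ⟨fun t => (hd t).differentiableAt, fun t => ?_⟩
  refine (hd t).deriv.trans_le ?_
  have hI : 0 ≤ ∫ s in (t - r)..t, Real.exp (η * (s - t)) * ‖x s‖ ^ 2 :=
    intervalIntegral.integral_nonneg (by linarith) fun s _ => by positivity
  have hI' := mul_nonneg (mul_nonneg hμ.le hη) hI
  have hAx := mul_le_mul_of_nonneg_left (hA (x t)) (by positivity : 0 ≤ 2 * σ)
  have hBφ := two_mul_inner_apply_le B hσ.le hε₁ (x t) (φ t)
  have hBu := two_mul_inner_apply_le B hσ.le hε₂ (x t) (u t)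
  have hsat : σ ^ 2 * ‖B‖ ^ 2 / ε₁ * ‖φ t‖ ^ 2 ≤
      σ ^ 2 * ‖B‖ ^ 2 / ε₁ * (cK * ‖x (t - r)‖) ^ 2 := by
    gcongr
    exact hφ t
  have hcoef : σ ^ 2 * ‖B‖ ^ 2 / ε₁ * (cK * ‖x (t - r)‖) ^ 2 =
      σ ^ 2 * ‖B‖ ^ 2 * cK ^ 2 / ε₁ * ‖x (t - r)‖ ^ 2 := by ring
  simp only [inner_add_right, Pi.pow_apply]
  linarith
end

section
/- Let T > 0, c > 0, let 0 = t_0 ≤ t_1 ≤ … ≤ t_{J+1} = T be a partition, let w : [0,T] → ℝ≥0 be integrable, let α_1, α_2 : ℝ≥0 → ℝ≥0 be class K∞ functions, let x : [0,T] → ℝ^n, and for each j ∈ {0,…,J} let V_j : [t_j, t_{j+1}] → ℝ≥0 be continuous, differentiable on (t_j, t_{j+1}) with V_j'(t) ≤ -c·V_j(t) + w(t) there, with V_{j+1}(t_{j+1}) ≤ V_j(t_{j+1}) for j < J, and with α_1(‖x(t)‖) ≤ V_j(t) for all t ∈ [t_j, t_{j+1}]. If V_0(0) ≤ α_2(c_0)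 for some c_0 ≥ 0, then for every j and every t ∈ [t_j, t_{j+1}], ‖x(t)‖ ≤ max{ α_1^{-1}( 2·e^{-ct}·α_2(c_0) ) , α_1^{-1}( 2·∫_0^t w(s) ds ) }. -/
open Set MeasureTheory

/-- Grönwall-type estimate for the differential inequality `f' ≤ -c f + w`, in exponentially
weighted form. -/
theorem exp_mul_le_add_integral_of_hasDerivAt_le {a b c : ℝ} {f w : ℝ → ℝ} (hab : a ≤ b)
    (hf : ContinuousOn f (Icc a b))
    (hd : ∀ s ∈ Ioo a b, ∃ d, HasDerivAt f d s ∧ d ≤ -c * f s + w s)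
    (hw : IntervalIntegrable w volume a b) :
    Real.exp (c * b) * f b ≤
      Real.exp (c * a) * f a + ∫ τ in a..b, Real.exp (c * τ) * w τ := by
  have hint : IntervalIntegrable (fun τ => Real.exp (c * τ) * w τ) volume a b :=
    hw.continuousOn_mul (by fun_prop)
  choose! d hder hle using hd
  have key := intervalIntegral.sub_le_integral_of_hasDeriv_right_of_le
    (g := fun s => Real.exp (c * s) * f s)
    (g' := fun s => Real.exp (c * s) * (c * 1) * f s + Real.exp (c * s) * d s)
    (φ := fun s => Real.exp (c * s) * w s) hab
    (ContinuousOn.mul (by fun_prop) hf)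
    (fun s hs =>
      ((((hasDerivAt_id' s).const_mul c).exp).mul (hder s hs)).hasDerivWithinAt)
    ((intervalIntegrable_iff_integrableOn_Icc_of_le hab).1 hint)
    (fun s hs => by nlinarith [hle s hs, Real.exp_pos (c * s)])
  linarith

/-- Discarding the decay of the kernel in a convolution with a decaying exponential. -/
theorem integral_exp_mul_le {c s : ℝ} {w : ℝ → ℝ} (hc : 0 ≤ c) (hs : 0 ≤ s)
    (hw0 : ∀ τ ∈ Icc 0 s, 0 ≤ w τ) (hw : IntervalIntegrable w volume 0 s) :
    ∫ τ in (0 : ℝ)..s, Real.exp (c * τ) * w τ ≤ Real.exp (c * s) * ∫ τ in (0 : ℝ)..s, w τ := by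
  rw [← intervalIntegral.integral_const_mul]
  refine intervalIntegral.integral_mono_on hs (hw.continuousOn_mul (by fun_prop))
    (hw.const_mul _) fun τ hτ => ?_
  have := hw0 τ hτ
  have := hτ.2
  gcongr

/-- iISS-form trajectory bound combining the piecewise exponential dissipation
estimate, the class `𝒦∞` sandwich bounds, and the weak triangle inequality. -/
theorem stmt15 (n : ℕ) (T : ℝ) (hT : 0 < T) (c : ℝ) (hc : 0 < c) (J : ℕ)
    (t : ℕ → ℝ) (ht0 : t 0 = 0) (htJ : t (J + 1) = T)
    (hmono : ∀ j ≤ J, t j ≤ t (j + 1))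
    (w : ℝ → ℝ) (hwnonneg : ∀ s ∈ Icc (0 : ℝ) T, 0 ≤ w s)
    (hw : IntervalIntegrable w volume 0 T)
    (α₁ α₂ : ℝ → ℝ) (hα₁ : IsClassKInf α₁) (hα₂ : IsClassKInf α₂)
    (α₁inv : ℝ → ℝ)
    (hinv₁ : ∀ s ≥ (0 : ℝ), α₁inv (α₁ s) = s)
    (hinv₂ : ∀ y ≥ (0 : ℝ), α₁ (α₁inv y) = y ∧ 0 ≤ α₁inv y)
    (x : ℝ → EuclideanSpace ℝ (Fin n))
    (V : ℕ → ℝ → ℝ)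
    (hVnonneg : ∀ j ≤ J, ∀ s ∈ Icc (t j) (t (j + 1)), 0 ≤ V j s)
    (hcont : ∀ j ≤ J, ContinuousOn (V j) (Icc (t j) (t (j + 1))))
    (hderiv : ∀ j ≤ J, ∀ s ∈ Ioo (t j) (t (j + 1)),
      ∃ d, HasDerivAt (V j) d s ∧ d ≤ -c * V j s + w s)
    (hjump : ∀ j < J, V (j + 1) (t (j + 1)) ≤ V j (t (j + 1)))
    (hlower : ∀ j ≤ J, ∀ s ∈ Icc (t j) (t (j + 1)), α₁ ‖x s‖ ≤ V j s)
    (c₀ : ℝ) (hc₀ : 0 ≤ c₀) (hV0 : V 0 0 ≤ α₂ c₀) :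
    ∀ j ≤ J, ∀ s ∈ Icc (t j) (t (j + 1)),
      ‖x s‖ ≤ max (α₁inv (2 * Real.exp (-c * s) * α₂ c₀))
        (α₁inv (2 * ∫ τ in (0 : ℝ)..s, w τ)) := by
  have htnonneg : ∀ j ≤ J + 1, 0 ≤ t j := by
    intro j
    induction j with
    | zero => intro _; exact ht0.ge
    | succ k ih => intro hk; exact (ih (by omega)).trans (hmono k (by omega))
  have htle : ∀ j ≤ J + 1, t j ≤ T := by
    intro j hj
    induction hj using Nat.decreasingInduction with
    | self => exact htJ.le
    | of_succ k hk ih => exact (hmono k (by omega)).trans ih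
  have hwsub : ∀ a b, 0 ≤ a → a ≤ b → b ≤ T → IntervalIntegrable w volume a b := by
    intro a b ha hab hb
    refine hw.mono_set ?_
    rw [uIcc_of_le hab, uIcc_of_le hT.le]
    exact Icc_subset_Icc ha hb
  have hstep : ∀ j ≤ J, ∀ s ∈ Icc (t j) (t (j + 1)),
      Real.exp (c * t j) * V j (t j) ≤
        α₂ c₀ + ∫ τ in (0 : ℝ)..t j, Real.exp (c * τ) * w τ →
      Real.exp (c * s) * V j s ≤ α₂ c₀ + ∫ τ in (0 : ℝ)..s, Real.exp (c * τ) * w τ := by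
    intro j hj s hs h
    have h0 := htnonneg j (by omega)
    have hsT := hs.2.trans (htle (j + 1) (by omega))
    have hw₁ := hwsub _ _ le_rfl h0 (hs.1.trans hsT)
    have hw₂ := hwsub _ _ h0 hs.1 hsT
    have hgron := exp_mul_le_add_integral_of_hasDerivAt_le (c := c) hs.1
      ((hcont j hj).mono (Icc_subset_Icc_right hs.2))
      (fun r hr => hderiv j hj r ⟨hr.1, hr.2.trans_le hs.2⟩) hw₂
    have hadd := intervalIntegral.integral_add_adjacent_intervals
      (hw₁.continuousOn_mul (f := w) (g := fun τ => Real.exp (c * τ)) (by fun_prop))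
      (hw₂.continuousOn_mul (f := w) (g := fun τ => Real.exp (c * τ)) (by fun_prop))
    linarith
  have hstart : ∀ j ≤ J, Real.exp (c * t j) * V j (t j) ≤
      α₂ c₀ + ∫ τ in (0 : ℝ)..t j, Real.exp (c * τ) * w τ := by
    intro j
    induction j with
    | zero => intro _; simpa [ht0] using hV0
    | succ k ih =>
      intro hk
      have hend := hstep k (by omega) _ (right_mem_Icc.2 (hmono k (by omega))) (ih (by omega))
      exact (mul_le_mul_of_nonneg_left (hjump k (by omega)) (Real.exp_pos _).le).trans hend
  intro j hj s hs
  have hs0 : 0 ≤ s := (htnonneg j (by omega)).trans hs.1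
  have hsT : s ≤ T := hs.2.trans (htle (j + 1) (by omega))
  have hws : ∀ τ ∈ Icc 0 s, 0 ≤ w τ := fun τ hτ => hwnonneg τ ⟨hτ.1, hτ.2.trans hsT⟩
  have hVs : V j s ≤ Real.exp (-c * s) * α₂ c₀ + ∫ τ in (0 : ℝ)..s, w τ := by
    have h₁ := hstep j hj s hs (hstart j hj)
    have h₂ := integral_exp_mul_le hc.le hs0 hws (hwsub _ _ le_rfl hs0 hsT)
    have hexp : Real.exp (c * s) * Real.exp (-c * s) = 1 := by
      rw [← Real.exp_add]; simp
    refine le_of_mul_le_mul_left ?_ (Real.exp_pos (c * s))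
    rw [mul_add, ← mul_assoc, hexp]
    linarith
  have hα₂0 : 0 ≤ α₂ c₀ := by
    have h := hVnonneg 0 (Nat.zero_le J) (t 0) (left_mem_Icc.2 (hmono 0 (Nat.zero_le J)))
    rw [ht0] at h
    exact h.trans hV0
  have hle_inv : ∀ y, 0 ≤ y → α₁ ‖x s‖ ≤ y → ‖x s‖ ≤ α₁inv y := by
    intro y hy h
    obtain ⟨heq, hnonneg⟩ := hinv₂ y hy
    exact (hα₁.1.2.1.le_iff_le (norm_nonneg _) hnonneg).1 (h.trans_eq heq.symm)
  have hbound := (hlower j hj s hs).trans hVs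
  rcases le_total (∫ τ in (0 : ℝ)..s, w τ) (Real.exp (-c * s) * α₂ c₀) with h | h
  · exact le_max_of_le_left (hle_inv _ (by positivity) (by linarith))
  · have := intervalIntegral.integral_nonneg (μ := volume) hs0 hws
    exact le_max_of_le_right (hle_inv _ (by positivity) (by linarith))
end
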